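/- Let X be a compact metric space equipped with a Borel probability measure dx, let d ≥ 3 be an integer, N₁, N₂ ≥ 1, and let z₁, …, z_{N₁+N₂} be points of X satisfying the quantitative equidistribution bound W₁((1/(N₁+N₂)) ∑_{k=1}^{N₁+N₂} δ_{z_k}, dx) ≤ C/(N₁+N₂)^{1/d} for some constant C > 0. Suppose the set {z₁, …, z_{N₁+N₂}} is partitioned into {x₁, …, x_{N₁}} and {y₁, …, y_{N₂}}. Then 𝐖₁^{1,1}((1/(N₁+N₂)) (∑_{i=1}^{N₁} δ_{x_i} − ∑_{j=1}^{N₂} δ_{y_j}), dx) ≤ 2N₂/(N₁+N₂) + C/(N₁+N₂)^{1/d}. -/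

import Mathlib

open MeasureTheory Filter Metric
open scoped ENNReal

section Defs

variable {X : Type*} [MeasurableSpace X] [MetricSpace X]

/-- A transference plan (coupling) between `μ` and `ν`: a measure on `X × X`
whose marginals are `μ` and `ν`. -/
def IsCoupling (μ ν : Measure X) (π : Measure (X × X)) : Prop :=
  π.map Prod.fst = μ ∧ π.map Prod.snd = ν

/-- The 1-Wasserstein distance between two (nonnegative) measures of equal mass:
the infimum over couplings of the transport cost. -/
noncomputable def W1 (μ ν : Measure X) : ℝ :=
  sInf { r : ℝ | ∃ π : Measure (X × X), IsCoupling μ ν π ∧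
    r = ∫ p : X × X, dist p.1 p.2 ∂π }

/-- The total variation norm `‖μ - ν‖` of the difference of two finite measures. -/
noncomputable def tvNorm (μ ν : Measure X) : ℝ :=
  ((μ - ν) Set.univ + (ν - μ) Set.univ).toReal

/-- The generalized Wasserstein distance `W₁^{a,b}` between two finite nonnegative
measures, possibly of different total mass (Piccoli–Rossi). -/
noncomputable def genW (a b : ℝ) (μ ν : Measure X) : ℝ :=
  sInf { r : ℝ | ∃ μ' ν' : Measure X, IsFiniteMeasure μ' ∧ IsFiniteMeasure ν' ∧
    μ' Set.univ = ν' Set.univ ∧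
    r = a * (tvNorm μ μ' + tvNorm ν ν') + b * W1 μ' ν' }

/-- The signed generalized Wasserstein distance `𝐖₁^{a,b}` between finite signed
measures, defined via the Jordan decompositions. -/
noncomputable def signedW (a b : ℝ) (μ ν : SignedMeasure X) : ℝ :=
  genW a b (μ.toJordanDecomposition.posPart + ν.toJordanDecomposition.negPart)
    (μ.toJordanDecomposition.negPart + ν.toJordanDecomposition.posPart)

/-- The empirical (probability) measure of the first `n` points of a sequence. -/
noncomputable def emp (x : ℕ → X) (n : ℕ) : Measure X :=
  (n : ℝ≥0∞)⁻¹ • ∑ k ∈ Finset.range n, Measure.dirac (x k)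

/-- The (unnormalized) empirical signed measure of the first `n` points of a sequence. -/
noncomputable def sEmp (x : ℕ → X) (n : ℕ) : SignedMeasure X :=
  ∑ k ∈ Finset.range n, (Measure.dirac (x k)).toSignedMeasure

end Defs

section Helpers

variable {X : Type*} [MeasurableSpace X]

lemma sub_real_univ_add_real_univ (μ ν : Measure X) [IsFiniteMeasure μ] [IsFiniteMeasure ν] :
    (μ - ν).real Set.univ + ν.real Set.univ = (ν - μ).real Set.univ + μ.real Set.univ := by
  have h := congrArg (fun s : SignedMeasure X => s Set.univ)
    (Measure.sub_toSignedMeasure_eq_toSignedMeasure_sub (μ := μ) (ν := ν))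
  simp only [Measure.toSignedMeasure_sub_apply MeasurableSet.univ] at h
  linarith

lemma toSignedMeasure_finset_sum {ι : Type*} (s : Finset ι) (m : ι → Measure X)
    [∀ i, IsFiniteMeasure (m i)] :
    (∑ i ∈ s, m i).toSignedMeasure = ∑ i ∈ s, (m i).toSignedMeasure := by
  classical
  induction s using Finset.induction_on with
  | empty => simp
  | insert i s hi ih =>
    rw [Measure.toSignedMeasure_congr (Finset.sum_insert hi), Measure.toSignedMeasure_add, ih,
      Finset.sum_insert hi]

lemma tvNorm_nonneg (μ ν : Measure X) : 0 ≤ tvNorm μ ν := ENNReal.toReal_nonneg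

lemma tvNorm_comm (μ ν : Measure X) : tvNorm μ ν = tvNorm ν μ := by
  rw [tvNorm, tvNorm, add_comm]

lemma tvNorm_of_le {μ ν : Measure X} [IsFiniteMeasure ν] (h : μ ≤ ν) :
    tvNorm μ ν = ν.real Set.univ - μ.real Set.univ := by
  have : IsFiniteMeasure μ := isFiniteMeasure_of_le ν h
  rw [tvNorm, Measure.sub_eq_zero_of_le h, Measure.sub_apply MeasurableSet.univ h]
  simp only [Measure.coe_zero, Pi.zero_apply, zero_add]
  exact ENNReal.toReal_sub_of_le (h _) (measure_ne_top ν _)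

variable [MetricSpace X]

lemma W1_nonneg (μ ν : Measure X) : 0 ≤ W1 μ ν := by
  refine Real.sInf_nonneg ?_
  rintro r ⟨π, -, rfl⟩
  exact integral_nonneg fun _ => dist_nonneg

lemma genW_le {a b : ℝ} (ha : 0 ≤ a) (hb : 0 ≤ b) (μ ν μ' ν' : Measure X)
    [IsFiniteMeasure μ'] [IsFiniteMeasure ν'] (h : μ' Set.univ = ν' Set.univ) :
    genW a b μ ν ≤ a * (tvNorm μ μ' + tvNorm ν ν') + b * W1 μ' ν' := by
  refine csInf_le ⟨0, ?_⟩ ⟨μ', ν', inferInstance, inferInstance, h, rfl⟩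
  rintro r ⟨σ, τ, -, -, -, rfl⟩
  have := tvNorm_nonneg μ σ
  have := tvNorm_nonneg ν τ
  have := W1_nonneg σ τ
  positivity

/-- Moving the negative part `β` of `α - β` to the positive side costs at most twice its mass. -/
lemma signedW_sub_le (α β ρ : Measure X) [IsFiniteMeasure α] [IsFiniteMeasure β]
    [IsFiniteMeasure ρ] (h : (α + β) Set.univ = ρ Set.univ) :
    signedW 1 1 (α.toSignedMeasure - β.toSignedMeasure) ρ.toSignedMeasure ≤
      2 * β.real Set.univ + W1 (α + β) ρ := by
  have hρ : ρ.toSignedMeasure = ρ.toSignedMeasure - (0 : Measure X).toSignedMeasure := by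
    simp
  rw [signedW, hρ, Measure.toJordanDecomposition_toSignedMeasure_sub,
    Measure.toJordanDecomposition_toSignedMeasure_sub]
  simp only [Measure.jordanDecompositionOfToSignedMeasureSub_posPart,
    Measure.jordanDecompositionOfToSignedMeasureSub_negPart, Measure.zero_sub, Measure.sub_zero,
    add_zero]
  refine (genW_le zero_le_one zero_le_one _ _ (α + β) ρ h).trans ?_
  rw [tvNorm_of_le (Measure.sub_le.trans (Measure.le_add_right le_rfl)), tvNorm_comm,
    tvNorm_of_le (Measure.le_add_left le_rfl), measureReal_add_apply, measureReal_add_apply]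
  linarith [sub_real_univ_add_real_univ α β]

end Helpers

/-- If the combined points `z` (partitioned into the `x`'s and the `y`'s)
satisfy the quantitative equidistribution bound `W₁ ≤ C/(N₁+N₂)^{1/d}`, then
`𝐖₁^{1,1}((1/(N₁+N₂))(∑δ_x − ∑δ_y), dx) ≤ 2N₂/(N₁+N₂) + C/(N₁+N₂)^{1/d}`. -/
theorem signedW_le_of_equidistributed {X : Type*} [MeasurableSpace X] [MetricSpace X]
    [BorelSpace X] [CompactSpace X] (dx : Measure X) [IsProbabilityMeasure dx]
    (d : ℕ) (hd : 3 ≤ d) (N₁ N₂ : ℕ) (h₁ : 1 ≤ N₁) (h₂ : 1 ≤ N₂)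
    (z : Fin (N₁ + N₂) → X) (x : Fin N₁ → X) (y : Fin N₂ → X)
    (e : Fin (N₁ + N₂) ≃ (Fin N₁ ⊕ Fin N₂)) (hz : ∀ k, z k = Sum.elim x y (e k))
    (C : ℝ) (hC : 0 < C)
    (hzW : W1 (((N₁ + N₂ : ℕ) : ℝ≥0∞)⁻¹ • ∑ k, Measure.dirac (z k)) dx ≤
      C / (((N₁ + N₂ : ℕ) : ℝ) ^ ((1 : ℝ) / d))) :
    signedW 1 1
      (((N₁ + N₂ : ℕ) : ℝ)⁻¹ •
        (∑ i : Fin N₁, (Measure.dirac (x i)).toSignedMeasure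
          - ∑ j : Fin N₂, (Measure.dirac (y j)).toSignedMeasure))
      dx.toSignedMeasure ≤
    2 * (N₂ : ℝ) / ((N₁ : ℝ) + N₂) + C / (((N₁ + N₂ : ℕ) : ℝ) ^ ((1 : ℝ) / d)) := by
  set n : NNReal := ((N₁ + N₂ : ℕ) : NNReal) with hn
  have hn0 : n ≠ 0 := by
    rw [hn]
    exact Nat.cast_ne_zero.2 (by omega)
  have hsum : ((N₁ + N₂ : ℕ) : ℝ≥0∞)⁻¹ • ∑ k, Measure.dirac (z k) =
      n⁻¹ • ∑ i, Measure.dirac (x i) + n⁻¹ • ∑ j, Measure.dirac (y j) := by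
    have hc : ((N₁ + N₂ : ℕ) : ℝ≥0∞)⁻¹ = ((n⁻¹ : NNReal) : ℝ≥0∞) := by
      rw [ENNReal.coe_inv hn0, hn, ENNReal.coe_natCast]
    have hs : ∑ k, Measure.dirac (z k) =
        ∑ i, Measure.dirac (x i) + ∑ j, Measure.dirac (y j) := by
      simp_rw [hz]
      rw [Equiv.sum_comp e fun s => Measure.dirac (Sum.elim x y s), Fintype.sum_sum_type]
      simp
    rw [hc, hs, smul_add]
    rfl
  have hsigned : ((N₁ + N₂ : ℕ) : ℝ)⁻¹ •
      (∑ i : Fin N₁, (Measure.dirac (x i)).toSignedMeasure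
        - ∑ j : Fin N₂, (Measure.dirac (y j)).toSignedMeasure) =
      (n⁻¹ • ∑ i, Measure.dirac (x i)).toSignedMeasure -
        (n⁻¹ • ∑ j, Measure.dirac (y j)).toSignedMeasure := by
    have hc : ((N₁ + N₂ : ℕ) : ℝ)⁻¹ = ((n⁻¹ : NNReal) : ℝ) := by
      rw [NNReal.coe_inv, hn, NNReal.coe_natCast]
    rw [Measure.toSignedMeasure_smul, Measure.toSignedMeasure_smul, toSignedMeasure_finset_sum,
      toSignedMeasure_finset_sum, smul_sub, hc]
    rfl
  have hmass : (n⁻¹ • ∑ j, Measure.dirac (y j)).real Set.univ = N₂ / ((N₁ : ℝ) + N₂) := by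
    rw [measureReal_nnreal_smul_apply, measureReal_def]
    simp [hn, Measure.finsetSum_apply, div_eq_inv_mul]
  have huniv : (n⁻¹ • ∑ i, Measure.dirac (x i) + n⁻¹ • ∑ j, Measure.dirac (y j)) Set.univ =
      dx Set.univ := by
    rw [← hsum, Measure.smul_apply, Measure.finsetSum_apply]
    simp only [measure_univ, Finset.sum_const, Finset.card_univ, Fintype.card_fin, smul_eq_mul,
      nsmul_eq_mul, mul_one]
    exact ENNReal.inv_mul_cancel (Nat.cast_ne_zero.2 (by omega)) (ENNReal.natCast_ne_top _)
  rw [hsum] at hzW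
  rw [hsigned]
  refine (signedW_sub_le _ _ dx huniv).trans ?_
  rw [hmass, mul_div_assoc]
  gcongr
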